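/- Suppose there exist symmetric positive definite matrices S̄_i ∈ ℝ^{n_x×n_x} and matrices Y_i ∈ ℝ^{n_u×n_x} (i = 1,…,N) such that the 2×2 block matrix [[S̄_i, (A_iS̄_i + BY_i)ᵀ],[A_iS̄_i + BY_i, S̄_j]] is positive definite for all i, j ∈ {1,…,N}. Then, setting K̄_i := Y_iS̄_i⁻¹, the feedback gain K(k,p) := Σ_{i=1}^N ξ_i(p_k)K̄_i (for k ∈ ℕ and sequences p : ℕ → ℙ) renders the closed-loop system x_{k+1} = (A(p_k) + BK(k,p))x_k poly-quadratically stable with poly-quadratic Lyapunov function V(π,x) = xᵀP(π)x where P(π) = Σ_{i=1}^N ξ_i(π)S̄_i⁻¹; in particular, the polytopic system with input matrix B is poly-quadratically stabilizable. -/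

import Mathlib

open Matrix

/-- A feedback gain `K(k,p)` renders the closed-loop system
`x_{k+1} = (A(p_k) + BK(k,p))x_k` poly-quadratically stable with poly-quadratic
Lyapunov function `V(π,x) = xᵀP(π)x`, `P(π) = Σᵢ ξᵢ(π)P̄ᵢ`. -/
def RendersClosedLoopPolyQS (nx nu np N : ℕ) (Pset : Set (Fin np → ℝ))
    (ξ : Fin N → Pset → ℝ) (A : Fin N → Matrix (Fin nx) (Fin nx) ℝ)
    (B : Matrix (Fin nx) (Fin nu) ℝ)
    (K : ℕ → (ℕ → Pset) → Matrix (Fin nu) (Fin nx) ℝ)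
    (Pb : Fin N → Matrix (Fin nx) (Fin nx) ℝ) : Prop :=
  ∃ a₁ a₂ a₃ : ℝ, 0 < a₁ ∧ 0 < a₂ ∧ 0 < a₃ ∧
    (∀ (π : Pset) (x : Fin nx → ℝ),
      a₁ * (x ⬝ᵥ x) ≤ x ⬝ᵥ ((∑ i, ξ i π • Pb i) *ᵥ x) ∧
      x ⬝ᵥ ((∑ i, ξ i π • Pb i) *ᵥ x) ≤ a₂ * (x ⬝ᵥ x)) ∧
    (∀ (p : ℕ → Pset) (k : ℕ) (x : Fin nx → ℝ),
      (((∑ i, ξ i (p k) • A i) + B * K k p) *ᵥ x) ⬝ᵥ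
          ((∑ i, ξ i (p (k + 1)) • Pb i) *ᵥ
            (((∑ i, ξ i (p k) • A i) + B * K k p) *ᵥ x))
        ≤ x ⬝ᵥ ((∑ i, ξ i (p k) • Pb i) *ᵥ x) - a₃ * (x ⬝ᵥ x))

/-- The polytopic system with input matrix `B` is poly-quadratically
stabilizable. -/
def PolyQStabilizable (nx nu np N : ℕ) (Pset : Set (Fin np → ℝ))
    (ξ : Fin N → Pset → ℝ) (A : Fin N → Matrix (Fin nx) (Fin nx) ℝ)
    (B : Matrix (Fin nx) (Fin nu) ℝ) : Prop :=
  ∃ (K : ℕ → (ℕ → Pset) → Matrix (Fin nu) (Fin nx) ℝ)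
    (Pb : Fin N → Matrix (Fin nx) (Fin nx) ℝ),
    (∀ i, (Pb i).IsSymm) ∧ RendersClosedLoopPolyQS nx nu np N Pset ξ A B K Pb

/-- A bound for a quadratic form on the unit sphere extends to the whole space by homogeneity. -/
theorem Matrix.mul_dotProduct_self_le_of_forall_unit {n : Type*} [Fintype n]
    {M : Matrix n n ℝ} {c : ℝ} (h : ∀ y : n → ℝ, y ⬝ᵥ y = 1 → c ≤ y ⬝ᵥ (M *ᵥ y))
    (x : n → ℝ) : c * (x ⬝ᵥ x) ≤ x ⬝ᵥ (M *ᵥ x) := by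
  by_cases hx : x = 0
  · simp [hx]
  have hpos : 0 < x ⬝ᵥ x := by simpa using dotProduct_star_self_pos_iff.2 hx
  have hsq : √(x ⬝ᵥ x) * √(x ⬝ᵥ x) = x ⬝ᵥ x := Real.mul_self_sqrt hpos.le
  have hs : √(x ⬝ᵥ x) ≠ 0 := (Real.sqrt_pos.2 hpos).ne'
  have hinv : (√(x ⬝ᵥ x))⁻¹ * (√(x ⬝ᵥ x))⁻¹ = (x ⬝ᵥ x)⁻¹ := by rw [← mul_inv, hsq]
  have key := h ((√(x ⬝ᵥ x))⁻¹ • x) (by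
    rw [smul_dotProduct, dotProduct_smul, smul_eq_mul, smul_eq_mul, ← mul_assoc, hinv,
      inv_mul_cancel₀ hpos.ne'])
  rw [mulVec_smul, smul_dotProduct, dotProduct_smul, smul_eq_mul, smul_eq_mul, ← mul_assoc,
    hinv, inv_mul_eq_div, le_div_iff₀ hpos] at key
  exact key

theorem isCompact_setOf_dotProduct_self_eq_one (n : Type*) [Fintype n] :
    IsCompact {x : n → ℝ | x ⬝ᵥ x = 1} := by
  refine Metric.isCompact_of_isClosed_isBounded
    (isClosed_eq (continuous_id.dotProduct continuous_id) continuous_const)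
    (isBounded_iff_forall_norm_le.2 ⟨1, fun x hx => ?_⟩)
  refine (pi_norm_le_iff_of_nonneg zero_le_one).2 fun i => ?_
  have hi : x i * x i ≤ x ⬝ᵥ x :=
    Finset.single_le_sum (f := fun i => x i * x i) (fun j _ => mul_self_nonneg (x j))
      (Finset.mem_univ i)
  rw [Set.mem_ofPred_eq.mp hx] at hi
  exact abs_le_one_iff_mul_self_le_one.2 hi

theorem Matrix.continuous_dotProduct_mulVec_self {n : Type*} [Fintype n] (M : Matrix n n ℝ) :
    Continuous fun x : n → ℝ => x ⬝ᵥ (M *ᵥ x) :=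
  continuous_id.dotProduct (continuous_const.matrix_mulVec continuous_id)

/-- Finitely many positive definite forms have a common coercivity constant. -/
theorem Matrix.exists_pos_forall_mul_dotProduct_self_le {ι n : Type*} [Finite ι] [Nonempty ι]
    [Fintype n] {M : ι → Matrix n n ℝ} (hM : ∀ i, (M i).PosDef) :
    ∃ c : ℝ, 0 < c ∧ ∀ i (x : n → ℝ), c * (x ⬝ᵥ x) ≤ x ⬝ᵥ (M i *ᵥ x) := by
  have h1 : ∀ i, ∃ c : ℝ, 0 < c ∧ ∀ x : n → ℝ, c * (x ⬝ᵥ x) ≤ x ⬝ᵥ (M i *ᵥ x) := by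
    intro i
    obtain ⟨c, hc, h⟩ := (isCompact_setOf_dotProduct_self_eq_one n).exists_forall_le'
      (M i).continuous_dotProduct_mulVec_self.continuousOn (a := 0) (fun x hx => by
        have hx0 : x ≠ 0 := by
          rintro rfl
          simp at hx
        simpa using (hM i).dotProduct_mulVec_pos hx0)
    exact ⟨c, hc, mul_dotProduct_self_le_of_forall_unit h⟩
  choose c hc h using h1
  obtain ⟨i₀, hi₀⟩ := Finite.exists_min c
  refine ⟨c i₀, hc i₀, fun i x => le_trans ?_ (h i x)⟩
  exact mul_le_mul_of_nonneg_right (hi₀ i) (by simpa using dotProduct_star_self_nonneg x)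

/-- Finitely many quadratic forms have a common upper bound. -/
theorem Matrix.exists_pos_forall_le_mul_dotProduct_self {ι n : Type*} [Finite ι] [Nonempty ι]
    [Fintype n] (M : ι → Matrix n n ℝ) :
    ∃ c : ℝ, 0 < c ∧ ∀ i (x : n → ℝ), x ⬝ᵥ (M i *ᵥ x) ≤ c * (x ⬝ᵥ x) := by
  have h1 : ∀ i, ∃ c : ℝ, ∀ x : n → ℝ, x ⬝ᵥ (M i *ᵥ x) ≤ c * (x ⬝ᵥ x) := by
    intro i
    obtain ⟨c, h⟩ := (isCompact_setOf_dotProduct_self_eq_one n).exists_bound_of_continuousOn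
      (M i).continuous_dotProduct_mulVec_self.continuousOn
    refine ⟨c, fun x => ?_⟩
    have key := mul_dotProduct_self_le_of_forall_unit (M := -M i) (c := -c) (fun y hy => by
      rw [neg_mulVec, dotProduct_neg]
      exact neg_le_neg ((le_abs_self _).trans (h y hy))) x
    rw [neg_mulVec, dotProduct_neg] at key
    linarith
  choose c h using h1
  obtain ⟨i₀, hi₀⟩ := Finite.exists_max c
  refine ⟨max (c i₀) 1, by positivity, fun i x => (h i x).trans ?_⟩
  exact mul_le_mul_of_nonneg_right ((hi₀ i).trans (le_max_left _ _))
    (by simpa using dotProduct_star_self_nonneg x)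

theorem Matrix.dotProduct_sum_smul_mulVec {ι n : Type*} [Fintype ι] [Fintype n]
    (w : ι → ℝ) (M : ι → Matrix n n ℝ) (x y : n → ℝ) :
    x ⬝ᵥ ((∑ i, w i • M i) *ᵥ y) = ∑ i, w i * (x ⬝ᵥ (M i *ᵥ y)) := by
  simp [sum_mulVec, dotProduct_sum, smul_mulVec]

/-- Jensen's inequality for a positive semidefinite quadratic form. -/
theorem Matrix.PosSemidef.dotProduct_mulVec_sum_smul_le {ι n : Type*} [Fintype ι] [Fintype n]
    {P : Matrix n n ℝ} (hP : P.PosSemidef) {w : ι → ℝ} (hw0 : ∀ i, 0 ≤ w i)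
    (hw1 : ∑ i, w i = 1) (v : ι → n → ℝ) :
    (∑ i, w i • v i) ⬝ᵥ (P *ᵥ ∑ i, w i • v i) ≤ ∑ i, w i * (v i ⬝ᵥ (P *ᵥ v i)) := by
  set z := ∑ i, w i • v i with hz
  have hsymm : ∀ a b : n → ℝ, a ⬝ᵥ (P *ᵥ b) = b ⬝ᵥ (P *ᵥ a) := fun a b => by
    have hPt : Pᵀ = P := by simpa using hP.isHermitian.eq
    rw [dotProduct_mulVec, ← mulVec_transpose, hPt, dotProduct_comm]
  have hcross : ∑ i, w i * (v i ⬝ᵥ (P *ᵥ z)) = z ⬝ᵥ (P *ᵥ z) := by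
    conv_rhs => rw [hz, sum_dotProduct]
    simp [smul_dotProduct, ← hz]
  have hdev : 0 ≤ ∑ i, w i * ((v i - z) ⬝ᵥ (P *ᵥ (v i - z))) :=
    Finset.sum_nonneg fun i _ => mul_nonneg (hw0 i) (by
      simpa using hP.dotProduct_mulVec_nonneg (v i - z))
  have hexpand : ∑ i, w i * ((v i - z) ⬝ᵥ (P *ᵥ (v i - z))) =
      ∑ i, w i * (v i ⬝ᵥ (P *ᵥ v i)) - 2 * ∑ i, w i * (v i ⬝ᵥ (P *ᵥ z)) +
        (∑ i, w i) * (z ⬝ᵥ (P *ᵥ z)) := by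
    rw [Finset.mul_sum, Finset.sum_mul, ← Finset.sum_sub_distrib, ← Finset.sum_add_distrib]
    refine Finset.sum_congr rfl fun i _ => ?_
    rw [mulVec_sub, sub_dotProduct, dotProduct_sub, dotProduct_sub, hsymm z (v i)]
    ring
  rw [hexpand, hcross, hw1] at hdev
  linarith

/-- The Lyapunov inequality `S⁻¹ - Fᵀ T⁻¹ F > 0` follows from the block inequality. -/
theorem Matrix.PosDef.inv_sub_transpose_mul_inv_mul {n : Type*} [Fintype n] [DecidableEq n]
    {S T F : Matrix n n ℝ} (hS : S.PosDef) (hT : T.PosDef)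
    (h : (fromBlocks S (F * S)ᵀ (F * S) T).PosDef) : (S⁻¹ - Fᵀ * T⁻¹ * F).PosDef := by
  have hSt : (S⁻¹)ᵀ = S⁻¹ := by simpa using hS.inv.isHermitian.eq
  have hTt : (T⁻¹)ᵀ = T⁻¹ := by simpa using hT.inv.isHermitian.eq
  have hSu : S * S⁻¹ = 1 := mul_nonsing_inv _ ((isUnit_iff_isUnit_det _).1 hS.isUnit)
  have hTu : T * T⁻¹ = 1 := mul_nonsing_inv _ ((isUnit_iff_isUnit_det _).1 hT.isUnit)
  have hSt' : Sᵀ = S := by simpa using hS.isHermitian.eq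
  refine PosDef.of_dotProduct_mulVec_pos ?_ fun x hx => ?_
  · simp [IsHermitian, conjTranspose_eq_transpose_of_trivial, hSt, hTt, transpose_mul,
      Matrix.mul_assoc]
  have hne : Sum.elim (S⁻¹ *ᵥ x) (-(T⁻¹ *ᵥ (F *ᵥ x))) ≠ 0 := by
    intro h0
    have h1 : S⁻¹ *ᵥ x = 0 := funext fun i => congrFun h0 (Sum.inl i)
    apply hx
    rw [← one_mulVec x, ← hSu, ← mulVec_mulVec, h1, mulVec_zero]
  have key := h.dotProduct_mulVec_pos hne
  have e1 : S *ᵥ (S⁻¹ *ᵥ x) = x := by rw [mulVec_mulVec, hSu, one_mulVec]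
  have e2 : T *ᵥ (T⁻¹ *ᵥ (F *ᵥ x)) = F *ᵥ x := by rw [mulVec_mulVec, hTu, one_mulVec]
  have e3 : (S⁻¹ *ᵥ x) ⬝ᵥ (S *ᵥ (Fᵀ *ᵥ (T⁻¹ *ᵥ (F *ᵥ x)))) =
      x ⬝ᵥ (Fᵀ *ᵥ (T⁻¹ *ᵥ (F *ᵥ x))) := by
    rw [dotProduct_mulVec, ← mulVec_transpose, hSt', e1]
  rw [fromBlocks_mulVec, star_trivial, sumElim_dotProduct_sumElim] at key
  simp only [Sum.elim_comp_inl, Sum.elim_comp_inr, transpose_mul, hSt', ← mulVec_mulVec,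
    mulVec_neg, e1, e2, dotProduct_add, dotProduct_neg, neg_dotProduct, e3] at key
  have e4 : (T⁻¹ *ᵥ (F *ᵥ x)) ⬝ᵥ (F *ᵥ x) = x ⬝ᵥ (Fᵀ *ᵥ (T⁻¹ *ᵥ (F *ᵥ x))) := by
    rw [dotProduct_mulVec x, vecMul_transpose, dotProduct_comm]
  rw [e4, dotProduct_comm (S⁻¹ *ᵥ x)] at key
  rw [star_trivial, sub_mulVec, dotProduct_sub, ← mulVec_mulVec, ← mulVec_mulVec]
  linarith

/-- Theorem 4 (T4.3 ⇒ T4.2): if the synthesis LMIs hold with `Yᵢ = K̄ᵢS̄ᵢ`, then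
the polytopic gain `K(k,p) = Σᵢ ξᵢ(p_k)K̄ᵢ`, with `K̄ᵢ = YᵢS̄ᵢ⁻¹`, renders the
closed-loop system poly-quadratically stable with poly-QLF
`V(π,x) = xᵀP(π)x`, `P(π) = Σᵢ ξᵢ(π)S̄ᵢ⁻¹`; in particular the system is
poly-quadratically stabilizable. -/
theorem polyQ_stabilizing_synthesis (nx nu np N : ℕ)
    (hnx : 0 < nx) (hnu : 0 < nu) (hnp : 0 < np) (hN : 0 < N)
    (Pset : Set (Fin np → ℝ)) (hPc : IsCompact Pset)
    (ξ : Fin N → Pset → ℝ)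
    (hξc : ∀ i, Continuous (ξ i))
    (hξ0 : ∀ i π, 0 ≤ ξ i π)
    (hξ1 : ∀ π, ∑ i, ξ i π = 1)
    (A : Fin N → Matrix (Fin nx) (Fin nx) ℝ)
    (B : Matrix (Fin nx) (Fin nu) ℝ)
    (S : Fin N → Matrix (Fin nx) (Fin nx) ℝ)
    (Y : Fin N → Matrix (Fin nu) (Fin nx) ℝ)
    (hS : ∀ i, (S i).PosDef)
    (hLMI : ∀ i j, (fromBlocks (S i) ((A i * S i + B * Y i)ᵀ)
        (A i * S i + B * Y i) (S j)).PosDef) :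
    RendersClosedLoopPolyQS nx nu np N Pset ξ A B
      (fun k p => ∑ i, ξ i (p k) • (Y i * (S i)⁻¹))
      (fun i => (S i)⁻¹) ∧
    PolyQStabilizable nx nu np N Pset ξ A B := by
  have hNe : Nonempty (Fin N) := ⟨⟨0, hN⟩⟩
  have hinv : ∀ i, ((S i)⁻¹).PosDef := fun i => (hS i).inv
  suffices hR : RendersClosedLoopPolyQS nx nu np N Pset ξ A B
      (fun k p => ∑ i, ξ i (p k) • (Y i * (S i)⁻¹)) (fun i => (S i)⁻¹) from
    ⟨hR, _, _, fun i => by simpa [IsSymm] using (hinv i).isHermitian.eq, hR⟩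
  let F : Fin N → Matrix (Fin nx) (Fin nx) ℝ := fun i => A i + B * (Y i * (S i)⁻¹)
  have hF : ∀ i, F i * S i = A i * S i + B * Y i := fun i => by
    have hu : (S i)⁻¹ * S i = 1 :=
      nonsing_inv_mul _ ((isUnit_iff_isUnit_det _).1 (hS i).isUnit)
    simp only [F, Matrix.add_mul, Matrix.mul_assoc, hu, Matrix.mul_one]
  obtain ⟨a₁, ha₁, h₁⟩ := exists_pos_forall_mul_dotProduct_self_le hinv
  obtain ⟨a₂, ha₂, h₂⟩ := exists_pos_forall_le_mul_dotProduct_self fun i => (S i)⁻¹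
  obtain ⟨a₃, ha₃, h₃⟩ := exists_pos_forall_mul_dotProduct_self_le
    (M := fun ij : Fin N × Fin N => (S ij.1)⁻¹ - (F ij.1)ᵀ * (S ij.2)⁻¹ * F ij.1)
    fun ij => (hS ij.1).inv_sub_transpose_mul_inv_mul (hS ij.2) (by
      rw [hF]
      exact hLMI ij.1 ij.2)
  have hconst : ∀ π (c : ℝ), c = ∑ i, ξ i π * c := fun π c => by
    rw [← Finset.sum_mul, hξ1, one_mul]
  refine ⟨a₁, a₂, a₃, ha₁, ha₂, ha₃, fun π x => ?_, fun p k x => ?_⟩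
  · rw [dotProduct_sum_smul_mulVec]
    constructor
    · rw [hconst π (a₁ * _)]
      exact Finset.sum_le_sum fun i _ => mul_le_mul_of_nonneg_left (h₁ i x) (hξ0 i π)
    · rw [hconst π (a₂ * _)]
      exact Finset.sum_le_sum fun i _ => mul_le_mul_of_nonneg_left (h₂ i x) (hξ0 i π)
  have hcl : ((∑ i, ξ i (p k) • A i) + B * ∑ i, ξ i (p k) • (Y i * (S i)⁻¹)) *ᵥ x =
      ∑ i, ξ i (p k) • (F i *ᵥ x) := by
    simp only [F, Matrix.mul_sum, Matrix.mul_smul, ← Finset.sum_add_distrib, ← smul_add,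
      sum_mulVec, smul_mulVec]
  have hstep : ∀ i j, (F i *ᵥ x) ⬝ᵥ ((S j)⁻¹ *ᵥ (F i *ᵥ x)) ≤
      x ⬝ᵥ ((S i)⁻¹ *ᵥ x) - a₃ * (x ⬝ᵥ x) := fun i j => by
    have h := h₃ (i, j) x
    rw [sub_mulVec, dotProduct_sub, ← mulVec_mulVec, ← mulVec_mulVec, dotProduct_mulVec x (F i)ᵀ,
      vecMul_transpose] at h
    linarith
  have hvertex : ∀ j, (∑ i, ξ i (p k) • (F i *ᵥ x)) ⬝ᵥ
      ((S j)⁻¹ *ᵥ ∑ i, ξ i (p k) • (F i *ᵥ x)) ≤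
      x ⬝ᵥ ((∑ i, ξ i (p k) • (S i)⁻¹) *ᵥ x) - a₃ * (x ⬝ᵥ x) := fun j => by
    refine ((hinv j).posSemidef.dotProduct_mulVec_sum_smul_le (hξ0 · (p k)) (hξ1 (p k)) _).trans ?_
    rw [dotProduct_sum_smul_mulVec, hconst (p k) (a₃ * _), ← Finset.sum_sub_distrib]
    refine Finset.sum_le_sum fun i _ => ?_
    rw [← mul_sub]
    exact mul_le_mul_of_nonneg_left (hstep i j) (hξ0 i (p k))
  rw [hcl, dotProduct_sum_smul_mulVec, hconst (p (k + 1)) (_ - _)]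
  exact Finset.sum_le_sum fun j _ => mul_le_mul_of_nonneg_left (hvertex j) (hξ0 j _)
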